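/- arXiv:2508.17907 — 2 statements merged into one kernel-verified Lean document; each statement's English description precedes it below -/
import Mathlib

section
/- Fix integers m ≥ 1 and n ≥ 2, and distinguish expert j among n experts. For each peer j' ≠ j, let q_{j'} : ℝ^m → ℝ be a measurable probability density that is everywhere strictly positive and radially symmetric at 0, and suppose the peer's report given ground truth θ ∈ ℝ^m has density x ↦ q_{j'}(x − θ) (a location family). Let π : ℝ^m → [0,∞) be a measurable probability density (expert j's posterior over the ground truth) that is strictly radially decreasing from a point x̂ ∈ ℝ^m (expert j's true prediction). Define expert j's expected utility of reporting w ∈ ℝ^m as Û(w) = ∫_{θ∈ℝ^m} ( ∫_{(ℝ^m)^{n−1}} 𝟙[‖w − θ‖ < ‖x_{j'} − θ‖ for all j' ≠ j] · ∏_{j'≠j} q_{j'}(x_{j'} − θ) dx_{−j} ) π(θ) dθ. Then for any u, v ∈ ℝ^m with ‖u − x̂‖ < ‖v − x̂‖ we have Û(u) > Û(v); in particular Û(x̂) > Û(w) for every w ≠ x̂, i.e., truthful reporting strictly maximizes expected utility (Theorem 1, oracular prediction competition is Bayes–Nash incentive compatible). -/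
open MeasureTheory

/-- Expert `j`'s expected utility of reporting `w` in the oracular prediction
competition: the probability (over the posterior over the ground truth `θ` and the
peers' reports, drawn independently from the location family `x ↦ q j' (x - θ)`)
that `w` is strictly closer to `θ` than every peer's report. -/
noncomputable def expUtil (m n : ℕ) (j : Fin n)
    (q : Fin n → EuclideanSpace ℝ (Fin m) → ℝ)
    (post : EuclideanSpace ℝ (Fin m) → ℝ)
    (w : EuclideanSpace ℝ (Fin m)) : ℝ :=
  ∫ θ : EuclideanSpace ℝ (Fin m),
    (∫ x : {j' : Fin n // j' ≠ j} → EuclideanSpace ℝ (Fin m),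
      (if ∀ j' : {j' : Fin n // j' ≠ j}, ‖w - θ‖ < ‖x j' - θ‖ then (1 : ℝ) else 0) *
        ∏ j' : {j' : Fin n // j' ≠ j}, q j'.1 (x j' - θ)) * post θ

lemma aux_setInt_pos {m : ℕ} (f : EuclideanSpace ℝ (Fin m) → ℝ) (hf : Integrable f)
    (hpos : ∀ x, 0 < f x) (s : Set (EuclideanSpace ℝ (Fin m))) (hs : IsOpen s)
    (hne : s.Nonempty) : 0 < ∫ y in s, f y := by
  rw [setIntegral_pos_iff_support_of_nonneg_ae
    (Filter.Eventually.of_forall fun x => (hpos x).le) hf.integrableOn]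
  have : Function.support f = Set.univ := by
    ext x; simp [(hpos x).ne']
  rw [this, Set.univ_inter]
  exact hs.measure_pos _ hne

lemma aux_open {m : ℕ} (r : ℝ) : IsOpen {y : EuclideanSpace ℝ (Fin m) | r < ‖y‖} :=
  isOpen_lt continuous_const continuous_norm

/-- single-peer tail is strictly decreasing. -/
lemma aux_tail_lt {m : ℕ} (hm : 1 ≤ m) (f : EuclideanSpace ℝ (Fin m) → ℝ) (hf : Integrable f)
    (hpos : ∀ x, 0 < f x) {r s : ℝ} (hr : 0 ≤ r) (hrs : r < s) :
    ∫ y in {y : EuclideanSpace ℝ (Fin m) | s < ‖y‖}, f y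
      < ∫ y in {y : EuclideanSpace ℝ (Fin m) | r < ‖y‖}, f y := by
  have : Nonempty (Fin m) := ⟨⟨0, hm⟩⟩
  have hB : IsOpen {y : EuclideanSpace ℝ (Fin m) | r < ‖y‖ ∧ ‖y‖ < s} :=
    (aux_open r).inter (isOpen_lt continuous_norm continuous_const)
  obtain ⟨y0, hy0⟩ := exists_norm_eq (EuclideanSpace ℝ (Fin m)) (c := (r + s) / 2) (by linarith)
  have h1 := aux_setInt_pos f hf hpos _ hB ⟨y0, by simp only [Set.mem_ofPred_eq, hy0]; constructor <;> linarith⟩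
  have hd : Disjoint {y : EuclideanSpace ℝ (Fin m) | s < ‖y‖}
      {y : EuclideanSpace ℝ (Fin m) | r < ‖y‖ ∧ ‖y‖ < s} := by
    rw [Set.disjoint_left]
    rintro y hy ⟨_, h2⟩
    exact lt_asymm hy h2
  have h2 := setIntegral_union hd hB.measurableSet hf.integrableOn hf.integrableOn
  have h3 : ∫ y in {y : EuclideanSpace ℝ (Fin m) | s < ‖y‖} ∪
      {y : EuclideanSpace ℝ (Fin m) | r < ‖y‖ ∧ ‖y‖ < s}, f y
      ≤ ∫ y in {y : EuclideanSpace ℝ (Fin m) | r < ‖y‖}, f y := by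
    apply setIntegral_mono_set hf.integrableOn
      (Filter.Eventually.of_forall fun x => (hpos x).le)
    apply LE.le.eventuallyLE
    rintro y (hy | hy)
    · exact lt_trans hrs hy
    · exact hy.1
  linarith

lemma aux_tail_pos {m : ℕ} (hm : 1 ≤ m) (f : EuclideanSpace ℝ (Fin m) → ℝ) (hf : Integrable f)
    (hpos : ∀ x, 0 < f x) (r : ℝ) :
    0 < ∫ y in {y : EuclideanSpace ℝ (Fin m) | r < ‖y‖}, f y := by
  have : Nonempty (Fin m) := ⟨⟨0, hm⟩⟩
  obtain ⟨y0, hy0⟩ := exists_norm_eq (EuclideanSpace ℝ (Fin m)) (c := |r| + 1) (by positivity)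
  refine aux_setInt_pos f hf hpos _ (aux_open r) ⟨y0, ?_⟩
  simp only [Set.mem_ofPred_eq, hy0]
  linarith [le_abs_self r]

lemma aux_tail_anti {m : ℕ} (f : EuclideanSpace ℝ (Fin m) → ℝ) (hf : Integrable f)
    (hpos : ∀ x, 0 < f x) {r s : ℝ} (hrs : r ≤ s) :
    ∫ y in {y : EuclideanSpace ℝ (Fin m) | s < ‖y‖}, f y
      ≤ ∫ y in {y : EuclideanSpace ℝ (Fin m) | r < ‖y‖}, f y := by
  apply setIntegral_mono_set hf.integrableOn
    (Filter.Eventually.of_forall fun x => (hpos x).le)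
  apply LE.le.eventuallyLE
  intro y hy
  exact lt_of_le_of_lt hrs hy

lemma aux_inner {m : ℕ} {ι : Type*} [Fintype ι] (q : ι → EuclideanSpace ℝ (Fin m) → ℝ)
    (w θ : EuclideanSpace ℝ (Fin m))
    (d : ∀ x : ι → EuclideanSpace ℝ (Fin m), Decidable (∀ i, ‖w - θ‖ < ‖x i - θ‖)) :
    (∫ x : ι → EuclideanSpace ℝ (Fin m),
      (@ite _ (∀ i, ‖w - θ‖ < ‖x i - θ‖) (d x) (1 : ℝ) 0) * ∏ i, q i (x i - θ))
    = ∏ i, ∫ y in {y : EuclideanSpace ℝ (Fin m) | ‖w - θ‖ < ‖y‖}, q i y := by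
  classical
  have h1 : ∀ x : ι → EuclideanSpace ℝ (Fin m),
      (@ite _ (∀ i, ‖w - θ‖ < ‖x i - θ‖) (d x) (1 : ℝ) 0) * ∏ i, q i (x i - θ)
      = ∏ i, ({y : EuclideanSpace ℝ (Fin m) | ‖w - θ‖ < ‖y‖}.indicator (q i) (x i - θ)) := by
    intro x
    by_cases h : ∀ i, ‖w - θ‖ < ‖x i - θ‖
    · rw [if_pos h, one_mul]
      refine Finset.prod_congr rfl fun i _ => ?_
      rw [Set.indicator_of_mem]
      exact h i
    · rw [if_neg h, zero_mul]
      push Not at h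
      obtain ⟨i, hi⟩ := h
      symm
      apply Finset.prod_eq_zero (Finset.mem_univ i)
      rw [Set.indicator_of_notMem]
      simpa using hi
  simp_rw [h1]
  rw [integral_fintype_prod_volume_eq_prod (fun i (y : EuclideanSpace ℝ (Fin m)) =>
    {y : EuclideanSpace ℝ (Fin m) | ‖w - θ‖ < ‖y‖}.indicator (q i) (y - θ))]
  refine Finset.prod_congr rfl fun i _ => ?_
  rw [integral_sub_right_eq_self (fun y => {y : EuclideanSpace ℝ (Fin m) | ‖w - θ‖ < ‖y‖}.indicator (q i) y) θ,
    integral_indicator (aux_open _).measurableSet]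

/-- The reflection argument. -/
lemma aux_main {m : ℕ} (G : ℝ → ℝ) (hGm : Measurable G) (C : ℝ) (hGb : ∀ r, ‖G r‖ ≤ C)
    (hG : ∀ r s, 0 ≤ r → r < s → G s < G r)
    (post : EuclideanSpace ℝ (Fin m) → ℝ) (hpostI : Integrable post)
    (xhat : EuclideanSpace ℝ (Fin m))
    (hdec : ∀ θ θ' : EuclideanSpace ℝ (Fin m),
      ‖θ - xhat‖ < ‖θ' - xhat‖ → post θ' < post θ)
    (u v : EuclideanSpace ℝ (Fin m)) (huv : ‖u - xhat‖ < ‖v - xhat‖) :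
    ∫ θ, G ‖v - θ‖ * post θ < ∫ θ, G ‖u - θ‖ * post θ := by
  set d := u - v with hd
  have hne : d ≠ 0 := by
    intro h
    rw [sub_eq_zero.mp h] at huv
    exact lt_irrefl _ huv
  have hd2 : 0 < ‖d‖ ^ 2 := by positivity
  set mid := (1 / 2 : ℝ) • (u + v) with hmid
  set ρ := (ℝ ∙ d)ᗮ.reflection with hρ
  have hρa : ∀ x, ρ x = x - (2 * (inner ℝ d x / ‖d‖ ^ 2)) • d := by
    intro x
    rw [hρ, Submodule.reflection_orthogonal_apply, Submodule.reflection_singleton_apply]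
    simp [mul_smul, two_smul]
  set σ : EuclideanSpace ℝ (Fin m) → EuclideanSpace ℝ (Fin m) := fun θ => ρ (θ - mid) + mid with hσ
  have hσmp : MeasurePreserving σ volume volume :=
    (measurePreserving_add_right volume mid).comp
      (ρ.measurePreserving.comp (measurePreserving_sub_right volume mid))
  have hσσ : ∀ θ, σ (σ θ) = θ := by intro θ; simp [hσ, hρ]
  have hu : u = mid + (1 / 2 : ℝ) • d := by rw [hmid, hd]; module
  have hv : v = mid - (1 / 2 : ℝ) • d := by rw [hmid, hd]; module
  have hσa : ∀ θ, σ θ = θ - (2 * (inner ℝ d (θ - mid) / ‖d‖ ^ 2)) • d := by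
    intro θ; simp only [hσ, hρa]; abel
  -- distances
  have key : ∀ θ x, ‖σ θ - x‖ ^ 2 - ‖θ - x‖ ^ 2
      = 4 * (inner ℝ d (θ - mid)) * (inner ℝ d (x - mid)) / ‖d‖ ^ 2 := by
    intro θ x
    have e : σ θ - x = (θ - x) - (2 * (inner ℝ d (θ - mid) / ‖d‖ ^ 2)) • d := by
      rw [hσa]; abel
    have e2 : inner ℝ (θ - x) d = inner ℝ d (θ - mid) - inner ℝ d (x - mid) := by
      rw [real_inner_comm, ← inner_sub_right]; congr 1; abel
    rw [e, norm_sub_sq_real, norm_smul, mul_pow, inner_smul_right, Real.norm_eq_abs, sq_abs, e2]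
    field_simp
    ring
  have key2 : ∀ x, ‖v - x‖ ^ 2 - ‖u - x‖ ^ 2 = 2 * inner ℝ d (x - mid) := by
    intro x
    have e1 : v - x = -((x - mid) + (1 / 2 : ℝ) • d) := by rw [hv]; abel
    have e2 : u - x = -((x - mid) - (1 / 2 : ℝ) • d) := by rw [hu]; abel
    rw [e1, e2, norm_neg, norm_neg, norm_add_sq_real (x - mid), norm_sub_sq_real (x - mid),
      inner_smul_right, real_inner_comm d (x - mid)]
    ring
  have hσu : σ u = v := by
    rw [hσa, hu]
    have : (2 * (inner ℝ d (mid + (1 / 2 : ℝ) • d - mid) / ‖d‖ ^ 2)) = 1 := by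
      rw [add_sub_cancel_left, inner_smul_right, real_inner_self_eq_norm_sq]
      field_simp
    rw [this, hv]; module
  have hσv : σ v = u := by rw [← hσu, hσσ]
  have hσn : ∀ x y, ‖σ x - σ y‖ = ‖x - y‖ := by
    intro x y
    have : σ x - σ y = ρ (x - y) := by
      simp only [hσ]
      rw [add_sub_add_right_eq_sub, ← map_sub, sub_sub_sub_cancel_right]
    rw [this, ρ.norm_map]
  have hx : 0 < inner ℝ d (xhat - mid) := by
    have := key2 xhat
    have h2 : ‖u - xhat‖ ^ 2 < ‖v - xhat‖ ^ 2 := by gcongr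
    linarith
  have hI : ∀ w, Integrable (fun θ => G ‖w - θ‖ * post θ) := by
    intro w
    refine hpostI.bdd_mul (c := C) ?_ (Filter.Eventually.of_forall fun θ => hGb _)
    exact (hGm.comp (by fun_prop)).aestronglyMeasurable
  have hσe : MeasurableEmbedding σ := by
    have : σ = (Homeomorph.mk (Equiv.mk σ σ hσσ hσσ)
      (by simp only [hσ]; fun_prop) (by simp only [hσ]; fun_prop)) := rfl
    rw [this]; exact Homeomorph.measurableEmbedding _
  have hc : ∀ f : EuclideanSpace ℝ (Fin m) → ℝ, ∫ θ, f (σ θ) = ∫ θ, f θ :=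
    fun f => hσmp.integral_comp hσe f
  have hgu : ∀ θ, ‖u - σ θ‖ = ‖v - θ‖ := fun θ => by rw [← hσv, hσn]
  have hgv : ∀ θ, ‖v - σ θ‖ = ‖u - θ‖ := fun θ => by rw [← hσu, hσn]
  have hIu : Integrable (fun θ => G ‖v - θ‖ * post (σ θ)) := by
    have := (hσmp.integrable_comp_emb hσe).mpr (hI u)
    simpa only [Function.comp_def, hgu] using this
  have hIv : Integrable (fun θ => G ‖u - θ‖ * post (σ θ)) := by
    have := (hσmp.integrable_comp_emb hσe).mpr (hI v)
    simpa only [Function.comp_def, hgv] using this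
  have cu := hc (fun θ => G ‖u - θ‖ * post θ)
  have cv := hc (fun θ => G ‖v - θ‖ * post θ)
  simp only [hgu, hgv] at cu cv
  have hsum : ∫ θ, (G ‖u - θ‖ - G ‖v - θ‖) * (post θ - post (σ θ))
      = 2 * ((∫ θ, G ‖u - θ‖ * post θ) - ∫ θ, G ‖v - θ‖ * post θ) := by
    have e : ∀ θ, (G ‖u - θ‖ - G ‖v - θ‖) * (post θ - post (σ θ))
      = (G ‖u - θ‖ * post θ - G ‖v - θ‖ * post θ)
        - (G ‖u - θ‖ * post (σ θ) - G ‖v - θ‖ * post (σ θ)) := fun θ => by ring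
    simp_rw [e]
    have i1 : Integrable (fun θ => G ‖u - θ‖ * post θ - G ‖v - θ‖ * post θ) := (hI u).sub (hI v)
    have i2 : Integrable (fun θ => G ‖u - θ‖ * post (σ θ) - G ‖v - θ‖ * post (σ θ)) :=
      hIv.sub hIu
    rw [integral_sub i1 i2, integral_sub (hI u) (hI v),
      integral_sub hIv hIu, cu, cv]
    ring
  have hprodI : Integrable (fun θ => (G ‖u - θ‖ - G ‖v - θ‖) * (post θ - post (σ θ))) := by
    have := ((hI u).sub (hI v)).sub (hIv.sub hIu)
    refine this.congr (Filter.Eventually.of_forall fun θ => ?_)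
    simp only [Pi.sub_apply]; ring
  have hposU : ∀ θ, 0 < inner ℝ d (θ - mid) →
      0 < (G ‖u - θ‖ - G ‖v - θ‖) * (post θ - post (σ θ)) := by
    intro θ h
    apply mul_pos
    · refine sub_pos.mpr (hG _ _ (norm_nonneg _) ?_)
      refine lt_of_pow_lt_pow_left₀ 2 (norm_nonneg _) ?_
      linarith [key2 θ]
    · refine sub_pos.mpr (hdec _ _ ?_)
      refine lt_of_pow_lt_pow_left₀ 2 (norm_nonneg _) ?_
      have : 0 < 4 * (inner ℝ d (θ - mid)) * (inner ℝ d (xhat - mid)) / ‖d‖ ^ 2 := by positivity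
      linarith [key θ xhat]
  have hnn : ∀ θ, 0 ≤ (G ‖u - θ‖ - G ‖v - θ‖) * (post θ - post (σ θ)) := by
    intro θ
    rcases lt_trichotomy 0 (inner ℝ d (θ - mid)) with h | h | h
    · exact (hposU θ h).le
    · rw [hσa, ← h]; simp
    · apply mul_nonneg_of_nonpos_of_nonpos
      · refine (sub_neg.mpr (hG _ _ (norm_nonneg _) ?_)).le
        refine lt_of_pow_lt_pow_left₀ 2 (norm_nonneg _) ?_
        linarith [key2 θ]
      · refine (sub_neg.mpr (hdec _ _ ?_)).le
        refine lt_of_pow_lt_pow_left₀ 2 (norm_nonneg _) ?_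
        have : 0 < 4 * (-inner ℝ d (θ - mid)) * (inner ℝ d (xhat - mid)) / ‖d‖ ^ 2 := by
          have := neg_pos.mpr h
          positivity
        have e : 4 * (-inner ℝ d (θ - mid)) * (inner ℝ d (xhat - mid)) / ‖d‖ ^ 2
          = - (4 * (inner ℝ d (θ - mid)) * (inner ℝ d (xhat - mid)) / ‖d‖ ^ 2) := by ring
        linarith [key θ xhat]
  have hopen : IsOpen {θ : EuclideanSpace ℝ (Fin m) | 0 < inner ℝ d (θ - mid)} :=
    isOpen_lt continuous_const (by fun_prop)
  have hfin : 0 < ∫ θ, (G ‖u - θ‖ - G ‖v - θ‖) * (post θ - post (σ θ)) := by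
    rw [integral_pos_iff_support_of_nonneg hnn hprodI]
    refine lt_of_lt_of_le (hopen.measure_pos volume ⟨xhat, hx⟩) (measure_mono ?_)
    intro θ hθ
    exact (hposU θ hθ).ne'
  linarith

/-- **Theorem 1 (oracular prediction competition is Bayes–Nash IC).**
If each peer's report has an everywhere positive density `q j'` which is radially
symmetric at `0` (so the report given ground truth `θ` has location-family density
`x ↦ q j' (x - θ)`), and expert `j`'s posterior `post` over the ground truth is a
density which is strictly radially decreasing from their true prediction `xhat`, then
moving a report strictly closer to `xhat` strictly increases expected utility; in
particular, the truthful report `xhat` uniquely maximizes expected utility. -/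
theorem oracular_competition_truthful_reporting
    (m n : ℕ) (hm : 1 ≤ m) (hn : 2 ≤ n) (j : Fin n)
    (q : Fin n → EuclideanSpace ℝ (Fin m) → ℝ)
    (hq_meas : ∀ j' : Fin n, j' ≠ j → Measurable (q j'))
    (hq_pos : ∀ j' : Fin n, j' ≠ j → ∀ x, 0 < q j' x)
    (hq_int : ∀ j' : Fin n, j' ≠ j → (∫ x : EuclideanSpace ℝ (Fin m), q j' x) = 1)
    (hq_radial : ∀ j' : Fin n, j' ≠ j → ∀ x y : EuclideanSpace ℝ (Fin m),
      ‖x‖ = ‖y‖ → q j' x = q j' y)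
    (post : EuclideanSpace ℝ (Fin m) → ℝ)
    (hpost_meas : Measurable post)
    (hpost_nonneg : ∀ θ, 0 ≤ post θ)
    (hpost_int : (∫ θ : EuclideanSpace ℝ (Fin m), post θ) = 1)
    (xhat : EuclideanSpace ℝ (Fin m))
    (hpost_dec : ∀ θ θ' : EuclideanSpace ℝ (Fin m),
      ‖θ - xhat‖ < ‖θ' - xhat‖ → post θ' < post θ) :
    (∀ u v : EuclideanSpace ℝ (Fin m), ‖u - xhat‖ < ‖v - xhat‖ →
      expUtil m n j q post v < expUtil m n j q post u) ∧
    (∀ w : EuclideanSpace ℝ (Fin m), w ≠ xhat →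
      expUtil m n j q post w < expUtil m n j q post xhat) := by
  have hqi : ∀ i : {j' : Fin n // j' ≠ j}, Integrable (q i.1) := fun i =>
    Integrable.of_integral_ne_zero (by rw [hq_int i.1 i.2]; exact one_ne_zero)
  have hpi : Integrable post :=
    Integrable.of_integral_ne_zero (by rw [hpost_int]; exact one_ne_zero)
  have : Nonempty {j' : Fin n // j' ≠ j} := by
    have : Nontrivial (Fin n) := Fin.nontrivial_iff_two_le.mpr hn
    obtain ⟨k, hk⟩ := exists_ne j
    exact ⟨⟨k, hk⟩⟩
  set G : ℝ → ℝ := fun r => ∏ i : {j' : Fin n // j' ≠ j},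
    ∫ y in {y : EuclideanSpace ℝ (Fin m) | r < ‖y‖}, q i.1 y with hGdef
  have hU : ∀ w, expUtil m n j q post w = ∫ θ, G ‖w - θ‖ * post θ := by
    intro w
    unfold expUtil
    congr 1
    ext θ
    congr 1
    exact aux_inner (fun i : {j' : Fin n // j' ≠ j} => q i.1) w θ _
  have hpos : ∀ (i : {j' : Fin n // j' ≠ j}) r,
      0 < ∫ y in {y : EuclideanSpace ℝ (Fin m) | r < ‖y‖}, q i.1 y := fun i r =>
    aux_tail_pos hm _ (hqi i) (hq_pos i.1 i.2) r
  have hanti : Antitone G := fun r s hrs =>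
    Finset.prod_le_prod (fun i _ => (hpos i s).le)
      (fun i _ => aux_tail_anti _ (hqi i) (hq_pos i.1 i.2) hrs)
  have hle : ∀ r, ‖G r‖ ≤ 1 := by
    intro r
    rw [Real.norm_of_nonneg (Finset.prod_nonneg fun i _ => (hpos i r).le)]
    refine Finset.prod_le_one (fun i _ => (hpos i r).le) (fun i _ => ?_)
    rw [← hq_int i.1 i.2]
    exact setIntegral_le_integral (hqi i)
      (Filter.Eventually.of_forall fun x => (hq_pos i.1 i.2 x).le)
  have hG : ∀ r s, 0 ≤ r → r < s → G s < G r := fun r s hr hrs =>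
    Finset.prod_lt_prod_of_nonempty (fun i _ => hpos i s)
      (fun i _ => aux_tail_lt hm _ (hqi i) (hq_pos i.1 i.2) hr hrs) Finset.univ_nonempty
  have hmain : ∀ u v : EuclideanSpace ℝ (Fin m), ‖u - xhat‖ < ‖v - xhat‖ →
      expUtil m n j q post v < expUtil m n j q post u := by
    intro u v huv
    rw [hU, hU]
    exact aux_main G hanti.measurable 1 hle hG post hpi xhat hpost_dec u v huv
  refine ⟨hmain, fun w hw => hmain _ _ ?_⟩
  rw [sub_self, norm_zero]
  exact norm_pos_iff.mpr (sub_ne_zero.mpr hw)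
end

section
/- Fix integers m ≥ 1 and n ≥ 2, a ground truth θ ∈ ℝ^m, and a distinguished expert j*. For each expert j let Q_j : ℝ^m → ℝ be a measurable probability density that is everywhere strictly positive and radially symmetric at θ, and suppose Q_{j*} satisfies the strict RMLRP with respect to Q_j at θ for every j ≠ j* (j* is the best expert). Let T_A, T_B : ℝ^m → ℝ be measurable probability densities that are radially symmetric at θ, strictly radially decreasing from θ, everywhere strictly positive, and such that T_A satisfies the strict RMLRP with respect to T_B at θ. For a density T define the win probability of expert j* as W(T) = ∫_{θ^s∈ℝ^m} ( ∫_{(ℝ^m)^n} 𝟙[‖x_{j*} − θ^s‖ < ‖x_j − θ^s‖ for all j ≠ j*] · ∏_{j=1}^n Q_j(x_j) dx ) T(θ^s) dθ^s. Then W(T_A) > W(T_B): the best expert has strictly higher probability of winning when the reference solution is drawn from T_A than from T_B (Theorem 2, efficiency). -/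
open MeasureTheory

/-- The win probability of expert `jstar` in the MSE-based competition when all
experts report independently from the densities `Q j` and the reference solution
is drawn from the density `T`. -/
noncomputable def winProb (m n : ℕ) (jstar : Fin n)
    (Q : Fin n → EuclideanSpace ℝ (Fin m) → ℝ)
    (T : EuclideanSpace ℝ (Fin m) → ℝ) : ℝ :=
  ∫ θs : EuclideanSpace ℝ (Fin m),
    (∫ x : Fin n → EuclideanSpace ℝ (Fin m),
      (if ∀ j : Fin n, j ≠ jstar → ‖x jstar - θs‖ < ‖x j - θs‖ then (1 : ℝ) else 0) *
        ∏ j : Fin n, Q j (x j)) * T θs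


/-- Slices null implies null. -/
lemma null_of_slice {ι : Type*} [Fintype ι] [DecidableEq ι] {E : Type*} [MeasureSpace E]
    [SigmaFinite (volume : Measure E)] [Nonempty E] (S : Set (ι → E)) (hS : MeasurableSet S) (k : ι)
    (h : ∀ x : ι → E, volume {y : E | Function.update x k y ∈ S} = 0) :
    volume S = 0 := by
  rw [← lintegral_indicator_one hS, volume_pi]
  have hf : Measurable (S.indicator (1 : (ι → E) → ENNReal)) := measurable_one.indicator hS
  obtain ⟨x0⟩ : Nonempty (ι → E) := inferInstance
  rw [lintegral_eq_lmarginal_univ x0, lmarginal_erase' _ hf (Finset.mem_univ k)]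
  have : (fun x : ι → E => ∫⁻ y, S.indicator (1 : (ι → E) → ENNReal) (Function.update x k y)) = 0 := by
    funext x
    have hm : MeasurableSet {y : E | Function.update x k y ∈ S} :=
      (measurable_update x) hS
    have := lintegral_indicator_one (μ := volume) hm
    rw [h x] at this
    simpa [Set.indicator] using this
  rw [this]
  simp [lmarginal]

/-- Counting lemma on crossings. -/
lemma crossing_exists {K : Type*} [Fintype K] (c d : K → ℝ) (s s' t : ℝ)
    (hts' : t ≤ s')
    (hge : ∀ k, 0 ≤ d k - t * c k) (hgt : ∀ k, c k ≤ 0 → 0 < d k - t * c k) (hst : s < t)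
    (hns : ¬ ∀ k, 0 < d k - s * c k)
    (h3 : ∀ k, d k - s * c k ≠ 0)
    (h2 : ∀ j k, j ≠ k → c j ≠ 0 → d j * c k ≠ d k * c j) :
    ∃ j, c j < 0 ∧ s * (-c j) < - d j ∧ - d j < s' * (-c j) ∧
      ∀ k, k ≠ j → 0 < - d k * c j + d j * c k := by
  classical
  push Not at hns
  obtain ⟨k0, hk0⟩ := hns
  have hk0' : d k0 - s * c k0 < 0 := lt_of_le_of_ne hk0 (h3 k0)
  have hck0 : c k0 < 0 := by
    by_contra hc
    push Not at hc
    nlinarith [hge k0]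
  obtain ⟨j, hj, hmax⟩ := Finset.exists_max_image (Finset.univ.filter (fun k => c k < 0))
    (fun k => d k / c k) ⟨k0, by simp [hck0]⟩
  simp only [Finset.mem_filter, Finset.mem_univ, true_and] at hj hmax
  have hdj : d j = (d j / c j) * c j := (div_mul_cancel₀ _ hj.ne).symm
  have hd0 : d k0 = (d k0 / c k0) * c k0 := (div_mul_cancel₀ _ hck0.ne).symm
  have h1 := hmax k0 hck0
  set r := d j / c j with hr
  have hr1 : s < r := by
    have : s < d k0 / c k0 := by
      rw [hd0] at hk0'
      nlinarith
    linarith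
  have hr2 : r < t := by
    have := hgt j hj.le
    rw [hdj] at this
    nlinarith
  refine ⟨j, hj, by nlinarith, by nlinarith, ?_⟩
  intro k hk
  rw [hdj]
  have key : 0 < d k - r * c k → 0 < - d k * c j + r * c j * c k := by
    intro h
    nlinarith
  apply key
  by_cases hck : c k < 0
  · have hle := hmax k hck
    have hdk : d k = (d k / c k) * c k := (div_mul_cancel₀ _ hck.ne).symm
    have hne : d k / c k ≠ r := by
      intro he
      apply h2 j k hk.symm hj.ne
      rw [hdj, hdk, he]; ring
    have : d k / c k < r := lt_of_le_of_ne hle hne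
    rw [hdk]
    nlinarith
  · push Not at hck
    rcases hck.eq_or_lt with h0 | h0
    · have := hgt k h0.symm.le
      rw [← h0] at this ⊢
      linarith
    · have := hge k
      nlinarith

open Classical in
lemma crossing_count {K : Type*} [Fintype K] (c d : K → ℝ) (s s' : ℝ) (hss : s < s')
    (h3 : ∀ k, d k - s * c k ≠ 0)
    (h2 : ∀ j k, j ≠ k → c j ≠ 0 → d j * c k ≠ d k * c j) :
    (∑ j, ((if (0 < c j ∧ s * c j < d j ∧ d j < s' * c j ∧
        ∀ k, k ≠ j → 0 < d k * c j - d j * c k) then (1:ℝ) else 0)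
      - (if (c j < 0 ∧ s * (-c j) < - d j ∧ - d j < s' * (-c j) ∧
      ∀ k, k ≠ j → 0 < - d k * c j + d j * c k) then (1:ℝ) else 0))) ≤
    (if ∀ k, 0 < d k - s * c k then (1:ℝ) else 0) - (if ∀ k, 0 < d k - s' * c k then (1:ℝ) else 0) := by
  rw [Finset.sum_sub_distrib]
  set U : K → Prop := fun j => (0 < c j ∧ s * c j < d j ∧ d j < s' * c j ∧
        ∀ k, k ≠ j → 0 < d k * c j - d j * c k) with hU
  set D : K → Prop := fun j => (c j < 0 ∧ s * (-c j) < - d j ∧ - d j < s' * (-c j) ∧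
      ∀ k, k ≠ j → 0 < - d k * c j + d j * c k) with hD
  change (∑ j, if U j then (1:ℝ) else 0) - (∑ j, if D j then (1:ℝ) else 0) ≤ _
  have hD0 : 0 ≤ ∑ j, if D j then (1:ℝ) else 0 :=
    Finset.sum_nonneg fun j _ => by split_ifs <;> norm_num
  have hD1 : (∃ j, D j) → 1 ≤ ∑ j, if D j then (1:ℝ) else 0 := by
    rintro ⟨j, hj⟩
    have := Finset.single_le_sum (f := fun j => if D j then (1:ℝ) else 0)
      (fun j _ => by split_ifs <;> norm_num) (Finset.mem_univ j)
    simpa [hj] using this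
  have hU0 : (∀ j, ¬ U j) → ∑ j, (if U j then (1:ℝ) else 0) = 0 := by
    intro h
    exact Finset.sum_eq_zero fun j _ => by simp [h j]
  have hU1 : ∑ j, (if U j then (1:ℝ) else 0) ≤ 1 := by
    by_cases h : ∃ j, U j
    · obtain ⟨j, hj⟩ := h
      rw [Finset.sum_eq_single j]
      · split_ifs <;> norm_num
      · intro k _ hk
        rw [if_neg]
        intro hk'
        have a := hj.2.2.2 k hk
        have b := hk'.2.2.2 j hk.symm
        linarith
      · simp
    · push Not at h
      rw [hU0 h]; norm_num
  by_cases hs' : ∀ k, 0 < d k - s' * c k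
  · have hnU : ∀ j, ¬ U j := by
      intro j hj
      have := hs' j
      linarith [hj.2.2.1]
    rw [hU0 hnU, if_pos hs']
    by_cases hs : ∀ k, 0 < d k - s * c k
    · rw [if_pos hs]; linarith
    · rw [if_neg hs]
      have := hD1 (crossing_exists c d s s' s' le_rfl (fun k => (hs' k).le) (fun k _ => hs' k) hss hs h3 h2)
      linarith
  · rw [if_neg hs']
    by_cases hs : ∀ k, 0 < d k - s * c k
    · rw [if_pos hs]; linarith
    · rw [if_neg hs]
      by_cases hU' : ∃ j, U j
      · obtain ⟨j, hj⟩ := hU'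
        obtain ⟨a1, a2, a3, a4⟩ := hj
        have hdj : d j = (d j / c j) * c j := (div_mul_cancel₀ _ a1.ne').symm
        set r := d j / c j with hr
        have hstr : ∀ k, k ≠ j → 0 < d k - r * c k := by
          intro k hk
          have := a4 k hk
          rw [hdj] at this
          by_contra hh
          push Not at hh
          nlinarith
        have := hD1 (crossing_exists c d s s' r (by rw [hdj] at a3; nlinarith)
          (fun k => by
            by_cases hk : k = j
            · subst hk; linarith
            · exact (hstr k hk).le)
          (fun k hc => by
            by_cases hk : k = j
            · subst hk; linarith
            · exact hstr k hk)
          (by rw [hdj] at a2; nlinarith) hs h3 h2)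
        linarith
      · push Not at hU'
        rw [hU0 hU']; linarith

section geom
set_option linter.unusedSectionVars false
set_option linter.unusedVariables false
variable {ι : Type*} [Fintype ι] [DecidableEq ι] {E : Type*} [NormedAddCommGroup E]
  [InnerProductSpace ℝ E]

/-- squared distance to the center -/
noncomputable def sqA (θ : E) (x : E) : ℝ := ‖x - θ‖ ^ 2
/-- twice the component along the ray -/
noncomputable def inB (θ u : E) (x : E) : ℝ := 2 * inner ℝ u (x - θ)

lemma sqA_cont (θ : E) : Continuous (sqA θ) := by unfold sqA; fun_prop
lemma inB_cont (θ u : E) : Continuous (inB θ u) := by unfold inB; fun_prop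

lemma norm_lt_iff (θ u x y : E) (t : ℝ) :
    ‖x - (θ + t • u)‖ < ‖y - (θ + t • u)‖ ↔
      0 < (sqA θ y - sqA θ x) - t * (inB θ u y - inB θ u x) := by
  have h : ∀ z : E, ‖z - (θ + t • u)‖ ^ 2 = sqA θ z - t * inB θ u z + ‖t • u‖ ^ 2 := by
    intro z
    rw [← sub_sub, norm_sub_sq_real, sqA, inB, inner_smul_right, real_inner_comm]
    ring
  rw [← pow_lt_pow_iff_left₀ (norm_nonneg _) (norm_nonneg _) two_ne_zero, h, h]
  constructor <;> intro h <;> linarith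

lemma norm_eq_of (θ u x y : E) (t : ℝ)
    (h0 : (sqA θ y - sqA θ x) - t * (inB θ u y - inB θ u x) = 0) :
    ‖y - (θ + t • u)‖ = ‖x - (θ + t • u)‖ := by
  have h1 := (norm_lt_iff θ u x y t).not.2 (by linarith)
  have h2 := (norm_lt_iff θ u y x t).not.2 (by linarith)
  linarith

/-- the leader `i` is overtaken by `j` along the ray between `s` and `s'` -/
def Jump (θ u : E) (s s' : ℝ) (i j : ι) (x : ι → E) : Prop :=
  inB θ u (x i) < inB θ u (x j) ∧
  s * (inB θ u (x j) - inB θ u (x i)) < sqA θ (x j) - sqA θ (x i) ∧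
  sqA θ (x j) - sqA θ (x i) < s' * (inB θ u (x j) - inB θ u (x i)) ∧
  ∀ k, k ≠ i → k ≠ j → sqA θ (x i) * inB θ u (x j) - sqA θ (x j) * inB θ u (x i) <
    sqA θ (x k) * (inB θ u (x j) - inB θ u (x i)) - (sqA θ (x j) - sqA θ (x i)) * inB θ u (x k)

lemma jump_open (θ u : E) (s s' : ℝ) (i j : ι) : IsOpen {x : ι → E | Jump θ u s s' i j x} := by
  have hA := sqA_cont θ
  have hB := inB_cont θ u
  have hA' : ∀ k : ι, Continuous fun x : ι → E => sqA θ (x k) := fun k => hA.comp (continuous_apply k)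
  have hB' : ∀ k : ι, Continuous fun x : ι → E => inB θ u (x k) := fun k => hB.comp (continuous_apply k)
  unfold Jump
  refine IsOpen.and (isOpen_lt (hB' _) (hB' _)) (IsOpen.and ?_ (IsOpen.and ?_ ?_))
  · exact isOpen_lt (by fun_prop) (by fun_prop)
  · exact isOpen_lt (by fun_prop) (by fun_prop)
  have : {x : ι → E | ∀ k, k ≠ i → k ≠ j → sqA θ (x i) * inB θ u (x j) - sqA θ (x j) * inB θ u (x i) <
    sqA θ (x k) * (inB θ u (x j) - inB θ u (x i)) - (sqA θ (x j) - sqA θ (x i)) * inB θ u (x k)}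
     = ⋂ k, {x : ι → E | k ≠ i → k ≠ j → sqA θ (x i) * inB θ u (x j) - sqA θ (x j) * inB θ u (x i) <
    sqA θ (x k) * (inB θ u (x j) - inB θ u (x i)) - (sqA θ (x j) - sqA θ (x i)) * inB θ u (x k)} := by
    ext x; simp
  rw [this]
  refine isOpen_iInter_of_finite fun k => ?_
  by_cases h1 : k ≠ i
  · by_cases h2 : k ≠ j
    · simp only [h1, h2, ne_eq, not_false_eq_true, forall_true_left]
      exact isOpen_lt (by fun_prop) (by fun_prop)
    · simp [h2]
  · simp [h1]

lemma jump_nonempty (θ u : E) (hu : ‖u‖ = 1) (s s' : ℝ) (hs : s < s') (i j : ι) (hij : i ≠ j) :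
    {x : ι → E | Jump θ u s s' i j x}.Nonempty := by
  set r := (s + s') / 2 with hr
  have hA : ∀ a : ℝ, sqA θ (θ + a • u) = a ^ 2 := by
    intro a; simp [sqA, norm_smul, hu]
  have hB : ∀ a : ℝ, inB θ u (θ + a • u) = 2 * a := by
    intro a; simp [inB, inner_smul_right, hu]
  refine ⟨fun k => θ + (if k = i then r - 1 else if k = j then r + 1 else r + 2 : ℝ) • u, ?_⟩
  simp only [Set.mem_ofPred_eq, Jump, hA, hB, if_true, if_neg hij.symm]
  refine ⟨by linarith, by nlinarith, by nlinarith, ?_⟩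
  intro k h1 h2
  simp only [if_neg h1, if_neg h2]
  nlinarith

lemma jump_swap (θ u : E) (s s' : ℝ) (i j : ι) (hij : i ≠ j) (x : ι → E) :
    Jump θ u s s' i j (fun k => x (Equiv.swap i j k)) ↔ Jump θ u s s' j i x := by
  unfold Jump
  simp only [Equiv.swap_apply_left, Equiv.swap_apply_right]
  refine and_congr Iff.rfl (and_congr Iff.rfl (and_congr Iff.rfl ?_))
  refine forall_congr' fun k => ⟨fun h h1 h2 => ?_, fun h h1 h2 => ?_⟩
  · simpa [Equiv.swap_apply_of_ne_of_ne h2 h1] using h h2 h1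
  · simpa [Equiv.swap_apply_of_ne_of_ne h1 h2] using h h2 h1

open Classical in
lemma win_count (θ u : E) (s s' : ℝ) (hs : s < s') (i : ι) (x : ι → E)
    (h3 : ∀ k, k ≠ i → ‖x k - (θ + s • u)‖ ≠ ‖x i - (θ + s • u)‖)
    (h2 : ∀ j k, j ≠ i → k ≠ i → j ≠ k → inB θ u (x j) ≠ inB θ u (x i) →
      (sqA θ (x j) - sqA θ (x i)) * (inB θ u (x k) - inB θ u (x i)) ≠
      (sqA θ (x k) - sqA θ (x i)) * (inB θ u (x j) - inB θ u (x i))) :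
    (∑ j : {j // j ≠ i}, ((if Jump θ u s s' i (j : ι) x then (1:ℝ) else 0)
       - (if Jump θ u s s' (j : ι) i x then (1:ℝ) else 0))) ≤
    (if ∀ j, j ≠ i → ‖x i - (θ + s • u)‖ < ‖x j - (θ + s • u)‖ then (1:ℝ) else 0) -
    (if ∀ j, j ≠ i → ‖x i - (θ + s' • u)‖ < ‖x j - (θ + s' • u)‖ then (1:ℝ) else 0) := by
  have := crossing_count (K := {j // j ≠ i}) (fun j => inB θ u (x j) - inB θ u (x i))
    (fun j => sqA θ (x j) - sqA θ (x i)) s s' hs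
    (fun k h => h3 k k.2 (norm_eq_of θ u _ _ _ h))
    (fun j k hjk hc => h2 j k j.2 k.2 (fun h => hjk (Subtype.ext h)) (sub_ne_zero.1 hc))
  convert this using 2
  · rename_i j _
    congr 2
    · rw [eq_iff_iff]
      unfold Jump
      constructor
      · rintro ⟨a, b, c, d⟩
        refine ⟨by linarith, b, c, fun k hk => ?_⟩
        have := d k k.2 (fun h => hk (Subtype.ext h))
        linarith
      · rintro ⟨a, b, c, d⟩
        refine ⟨by linarith, b, c, fun k h1 hk => ?_⟩
        have := d ⟨k, h1⟩ (fun h => hk (congrArg Subtype.val h))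
        simp only at this
        linarith
    · rw [eq_iff_iff]
      unfold Jump
      constructor
      · rintro ⟨a, b, c, d⟩
        refine ⟨by linarith, by linarith, by linarith, fun k hk => ?_⟩
        have := d k (fun h => hk (Subtype.ext h)) k.2
        linarith
      · rintro ⟨a, b, c, d⟩
        refine ⟨by linarith, by linarith, by linarith, fun k hk h1 => ?_⟩
        have := d ⟨k, h1⟩ (fun h => hk (congrArg Subtype.val h))
        simp only at this
        linarith
  · congr 1
    simp only [norm_lt_iff, Subtype.forall]
  · simp only [norm_lt_iff, Subtype.forall]

variable [FiniteDimensional ℝ E] [MeasurableSpace E] [BorelSpace E] [Nontrivial E]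

lemma tie_null (θ u : E) (s : ℝ) (i k : ι) (hk : k ≠ i) :
    ∀ᵐ x : ι → E, ‖x k - (θ + s • u)‖ ≠ ‖x i - (θ + s • u)‖ := by
  rw [ae_iff]
  refine null_of_slice _ ?_ k ?_
  · simp only [ne_eq, not_not]
    exact (isClosed_eq (by fun_prop) (by fun_prop)).measurableSet
  · intro x
    refine measure_mono_null ?_ (Measure.addHaar_sphere volume (θ + s • u) (‖x i - (θ + s • u)‖))
    intro y hy
    simpa [Function.update_of_ne hk.symm, dist_eq_norm] using hy

lemma triple_null (θ u : E) (i j k : ι) (hji : j ≠ i) (hk : k ≠ i) (hjk : j ≠ k) :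
    ∀ᵐ x : ι → E, inB θ u (x j) ≠ inB θ u (x i) →
      (sqA θ (x j) - sqA θ (x i)) * (inB θ u (x k) - inB θ u (x i)) ≠
      (sqA θ (x k) - sqA θ (x i)) * (inB θ u (x j) - inB θ u (x i)) := by
  have hA := sqA_cont θ
  have hB := inB_cont θ u
  have hA' : ∀ k : ι, Continuous fun x : ι → E => sqA θ (x k) := fun k => hA.comp (continuous_apply k)
  have hB' : ∀ k : ι, Continuous fun x : ι → E => inB θ u (x k) := fun k => hB.comp (continuous_apply k)
  rw [ae_iff]
  refine null_of_slice _ ?_ k ?_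
  · simp only [ne_eq, not_not, Classical.not_imp]
    exact (isClosed_eq (hB' _) (hB' _)).measurableSet.compl.inter
      (isClosed_eq (by fun_prop) (by fun_prop)).measurableSet
  · intro x
    by_cases hne : inB θ u (x j) - inB θ u (x i) = 0
    · convert measure_empty (μ := volume)
      ext y
      have : inB θ u (x j) = inB θ u (x i) := by linarith
      simp [Function.update_of_ne hk.symm, Function.update_of_ne hjk, this]
    set t := (sqA θ (x j) - sqA θ (x i)) / (inB θ u (x j) - inB θ u (x i)) with ht
    refine measure_mono_null ?_ (Measure.addHaar_sphere volume (θ + t • u) (‖x i - (θ + t • u)‖))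
    intro y hy
    simp only [ne_eq, not_not, Classical.not_imp, Set.mem_ofPred_eq, Function.update_of_ne hk.symm,
      Function.update_of_ne hjk, Function.update_self] at hy
    rw [mem_sphere_iff_norm]
    apply norm_eq_of
    rw [ht]
    field_simp
    linarith [hy.2]

end geom

section win
set_option linter.unusedSectionVars false
variable {ι : Type*} [Fintype ι] [DecidableEq ι] {E : Type*} [NormedAddCommGroup E]
  [InnerProductSpace ℝ E] [FiniteDimensional ℝ E] [MeasurableSpace E] [BorelSpace E] [Nontrivial E]

/-- conditional win probability -/
noncomputable def wfun [∀ (x : ι → E) (i : ι) (t : E), Decidable (∀ j, j ≠ i → ‖x i - t‖ < ‖x j - t‖)]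
    (i : ι) (Q : ι → E → ℝ) (t : E) : ℝ :=
  ∫ x : ι → E, (if ∀ j, j ≠ i → ‖x i - t‖ < ‖x j - t‖ then (1 : ℝ) else 0) * ∏ j, Q j (x j)

variable [∀ (x : ι → E) (i : ι) (t : E), Decidable (∀ j, j ≠ i → ‖x i - t‖ < ‖x j - t‖)]

lemma win_meas (i : ι) : MeasurableSet {p : E × (ι → E) | ∀ j, j ≠ i → ‖p.2 i - p.1‖ < ‖p.2 j - p.1‖} := by
  have : {p : E × (ι → E) | ∀ j, j ≠ i → ‖p.2 i - p.1‖ < ‖p.2 j - p.1‖} =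
    ⋂ j, {p : E × (ι → E) | j ≠ i → ‖p.2 i - p.1‖ < ‖p.2 j - p.1‖} := by
    ext; simp
  rw [this]
  refine MeasurableSet.iInter fun j => ?_
  by_cases h : j ≠ i
  · simp only [h, ne_eq, not_false_eq_true, forall_true_left]
    exact (isOpen_lt (by fun_prop) (by fun_prop)).measurableSet
  · simp [h]

lemma integrable_ite {X : Type*} [MeasurableSpace X] {μ : Measure X} {f : X → ℝ} (hf : Integrable f μ)
    (p : X → Prop) [DecidablePred p] (hp : MeasurableSet {x | p x}) :
    Integrable (fun x => (if p x then (1:ℝ) else 0) * f x) μ := by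
  have : (fun x => (if p x then (1:ℝ) else 0) * f x) = {x | p x}.indicator f := by
    ext x; simp [Set.indicator]
  rw [this]
  exact hf.indicator hp

lemma wfun_rot (i : ι) (Q : ι → E → ℝ) (θ : E)
    (hrad : ∀ j, ∀ x y : E, ‖x - θ‖ = ‖y - θ‖ → Q j x = Q j y) (t t' : E)
    (h : ‖t - θ‖ = ‖t' - θ‖) : wfun i Q t = wfun i Q t' := by
  set R : E ≃ₗᵢ[ℝ] E := (ℝ ∙ ((t - θ) - (t' - θ)))ᗮ.reflection with hR
  have hRt : R (t - θ) = t' - θ := Submodule.reflection_sub h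
  let e : E ≃ᵐ E := ((MeasurableEquiv.subRight θ).trans R.toMeasurableEquiv).trans
    (MeasurableEquiv.addRight θ)
  have he : ∀ y, e y = R (y - θ) + θ := fun y => rfl
  have hmp : MeasurePreserving e volume volume :=
    ((measurePreserving_sub_right volume θ).trans
      (R.measurePreserving)).trans (measurePreserving_add_right volume θ)
  let F : (ι → E) ≃ᵐ (ι → E) := MeasurableEquiv.piCongrRight fun _ => e
  have hF : MeasurePreserving F volume volume := volume_preserving_pi fun _ => hmp
  unfold wfun
  rw [← hF.integral_comp' (fun x : ι → E =>
    (if ∀ j, j ≠ i → ‖x i - t'‖ < ‖x j - t'‖ then (1 : ℝ) else 0) * ∏ j, Q j (x j))]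
  have hn : ∀ y, ‖e y - t'‖ = ‖y - t‖ := by
    intro y
    have : e y - t' = R (y - t) := by
      have h1 : y - t = (y - θ) - (t - θ) := by abel
      rw [h1, map_sub, hRt, he]; abel
    rw [this, R.norm_map]
  have hq : ∀ j y, Q j (e y) = Q j y := by
    intro j y
    apply hrad
    rw [he, add_sub_cancel_right, R.norm_map]
  have hFx : ∀ x j, F x j = e (x j) := fun x j => rfl
  simp only [hFx, hn, hq]

lemma wfun_ray (i : ι) (Q : ι → E → ℝ) (θ u : E) (hu : ‖u‖ = 1) (s s' : ℝ) (hs0 : 0 ≤ s) (hs : s < s')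
    (hex : ∃ j, j ≠ i)
    (hpos : ∀ j x, 0 < Q j x)
    (hint : Integrable (fun x : ι → E => ∏ j, Q j (x j)))
    (hml : ∀ j, j ≠ i → ∀ x y : E, ‖x - θ‖ < ‖y - θ‖ → Q i y * Q j x < Q i x * Q j y) :
    wfun i Q (θ + s' • u) < wfun i Q (θ + s • u) := by
  classical
  set P : (ι → E) → ℝ := fun x => ∏ j, Q j (x j) with hP
  have hJm : ∀ a b : ι, MeasurableSet {x : ι → E | Jump θ u s s' a b x} :=
    fun a b => (jump_open θ u s s' a b).measurableSet
  have hJi : ∀ a b : ι, Integrable (fun x => (if Jump θ u s s' a b x then (1:ℝ) else 0) * P x) :=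
    fun a b => integrable_ite hint _ (hJm a b)
  have hWm : ∀ t : E, MeasurableSet {x : ι → E | ∀ j, j ≠ i → ‖x i - t‖ < ‖x j - t‖} := fun t =>
    (win_meas i).preimage (f := fun x : ι → E => (t, x)) (by fun_prop)
  have hWi : ∀ t : E, Integrable (fun x : ι → E =>
      (if ∀ j, j ≠ i → ‖x i - t‖ < ‖x j - t‖ then (1 : ℝ) else 0) * P x) :=
    fun t => integrable_ite hint _ (hWm t)
  -- pairwise positivity
  have hpair : ∀ j, j ≠ i → 0 < (∫ x, (if Jump θ u s s' i j x then (1:ℝ) else 0) * P x) -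
      ∫ x, (if Jump θ u s s' j i x then (1:ℝ) else 0) * P x := by
    intro j hj
    let F : (ι → E) ≃ᵐ (ι → E) := MeasurableEquiv.piCongrLeft (fun _ => E) (Equiv.swap i j)
    have hF : MeasurePreserving F volume volume :=
      volume_measurePreserving_piCongrLeft (fun _ => E) (Equiv.swap i j)
    have hFx : ∀ x, F x = fun k => x (Equiv.swap i j k) := by
      intro x
      funext k
      have := MeasurableEquiv.piCongrLeft_apply_apply (β := fun _ : ι => E) (Equiv.swap i j) x
        (Equiv.swap i j k)
      simpa using this
    have hJi' : Integrable (fun x => (if Jump θ u s s' j i (F x) then (1:ℝ) else 0) * P (F x)) := (hF.integrable_comp_emb F.measurableEmbedding).2 (hJi j i)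
    rw [← hF.integral_comp' (fun x => (if Jump θ u s s' j i x then (1:ℝ) else 0) * P x),
      ← integral_sub (hJi i j) hJi']
    have hJF : ∀ x, Jump θ u s s' j i (F x) ↔ Jump θ u s s' i j x := by
      intro x
      rw [hFx, Equiv.swap_comm, jump_swap θ u s s' j i hj]
    have hkey : ∀ x, Jump θ u s s' i j x → P (F x) < P x := by
      intro x hx
      have hlt : ‖x i - θ‖ < ‖x j - θ‖ := by
        have h1 : sqA θ (x i) < sqA θ (x j) := by nlinarith [hx.1, hx.2.1]
        exact (pow_lt_pow_iff_left₀ (norm_nonneg _) (norm_nonneg _) two_ne_zero).1 h1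
      have hspl : ∀ z : ι → E, P z = (Q i (z i) * Q j (z j)) *
          ∏ k ∈ (Finset.univ.erase i).erase j, Q k (z k) := by
        intro z
        rw [hP]
        dsimp only
        rw [← Finset.mul_prod_erase _ _ (Finset.mem_univ i),
          ← Finset.mul_prod_erase _ _ (Finset.mem_erase.2 ⟨hj, Finset.mem_univ j⟩), mul_assoc]
      rw [hspl, hspl x, hFx]
      simp only [Equiv.swap_apply_left, Equiv.swap_apply_right]
      have hrest : ∏ k ∈ (Finset.univ.erase i).erase j, Q k (x (Equiv.swap i j k)) =
          ∏ k ∈ (Finset.univ.erase i).erase j, Q k (x k) := by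
        refine Finset.prod_congr rfl fun k hk => ?_
        simp only [Finset.mem_erase, Finset.mem_univ, and_true] at hk
        rw [Equiv.swap_apply_of_ne_of_ne hk.2 hk.1]
      rw [hrest]
      exact mul_lt_mul_of_pos_right (hml j hj _ _ hlt) (Finset.prod_pos fun k _ => hpos _ _)
    rw [integral_pos_iff_support_of_nonneg]
    · refine lt_of_lt_of_le ((jump_open θ u s s' i j).measure_pos volume
        (jump_nonempty θ u hu s s' hs i j hj.symm)) (measure_mono ?_)
      intro x hx
      have hx' : Jump θ u s s' i j x := hx
      simp only [Function.mem_support, hJF, if_pos hx', one_mul]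
      exact (sub_pos.2 (hkey x hx')).ne'
    · intro x
      by_cases hx : Jump θ u s s' i j x
      · simp only [hJF, if_pos hx, one_mul, Pi.zero_apply]
        exact (sub_pos.2 (hkey x hx)).le
      · simp [hJF, hx]
    · exact (hJi i j).sub hJi'
  have hsum : 0 < ∫ x, (∑ j : {j // j ≠ i}, ((if Jump θ u s s' i (j:ι) x then (1:ℝ) else 0)
       - (if Jump θ u s s' (j:ι) i x then (1:ℝ) else 0))) * P x := by
    simp only [Finset.sum_mul, sub_mul]
    rw [integral_finsetSum]
    · obtain ⟨j0, hj0⟩ := hex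
      refine Finset.sum_pos (fun j _ => ?_) ⟨⟨j0, hj0⟩, Finset.mem_univ _⟩
      rw [integral_sub (hJi _ _) (hJi _ _)]
      exact hpair j j.2
    · exact fun j _ => (hJi _ _).sub (hJi _ _)
  have hsi : Integrable fun x => (∑ j : {j // j ≠ i}, ((if Jump θ u s s' i (j:ι) x then (1:ℝ) else 0)
       - (if Jump θ u s s' (j:ι) i x then (1:ℝ) else 0))) * P x := by
    simp only [Finset.sum_mul, sub_mul]
    exact integrable_finsetSum _ fun j _ => (hJi _ _).sub (hJi _ _)
  rw [← sub_pos]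
  unfold wfun
  rw [← integral_sub (hWi _) (hWi _)]
  refine hsum.trans_le (integral_mono_ae hsi ((hWi _).sub (hWi _)) ?_)
  have h3 : ∀ᵐ x : ι → E, ∀ k, k ≠ i → ‖x k - (θ + s • u)‖ ≠ ‖x i - (θ + s • u)‖ := by
    rw [ae_all_iff]; intro k
    by_cases hk : k = i
    · simp [hk]
    · filter_upwards [tie_null θ u s i k hk] with x hx _ using hx
  have h2 : ∀ᵐ x : ι → E, ∀ j k, j ≠ i → k ≠ i → j ≠ k → inB θ u (x j) ≠ inB θ u (x i) →
      (sqA θ (x j) - sqA θ (x i)) * (inB θ u (x k) - inB θ u (x i)) ≠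
      (sqA θ (x k) - sqA θ (x i)) * (inB θ u (x j) - inB θ u (x i)) := by
    rw [ae_all_iff]; intro j
    rw [ae_all_iff]; intro k
    by_cases hj : j = i
    · simp [hj]
    by_cases hk : k = i
    · simp [hk]
    by_cases hjk : j = k
    · simp [hjk]
    filter_upwards [triple_null θ u i j k hj hk hjk] with x hx _ _ _ using hx
  filter_upwards [h2, h3] with x hx2 hx3
  have := win_count θ u s s' hs i x hx3 hx2
  have hPx : 0 ≤ P x := Finset.prod_nonneg fun j _ => (hpos _ _).le
  have := mul_le_mul_of_nonneg_right this hPx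
  rw [sub_mul] at this
  convert this

end win

/-- **Theorem 2 (efficiency).** If `jstar` is the best expert (its density satisfies
the strict radial MLRP at the ground truth `θ` with respect to every other expert's
density), and the reference-solution densities `TA`, `TB` are radially symmetric at
`θ`, strictly radially decreasing from `θ`, positive, with `TA` satisfying the strict
radial MLRP with respect to `TB` at `θ`, then the best expert has a strictly higher
probability of winning when the reference solution is drawn from `TA` than from `TB`. -/
theorem best_expert_wins_more_with_more_precise_reference
    (m n : ℕ) (hm : 1 ≤ m) (hn : 2 ≤ n)
    (θ : EuclideanSpace ℝ (Fin m)) (jstar : Fin n)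
    (Q : Fin n → EuclideanSpace ℝ (Fin m) → ℝ)
    (hQ_meas : ∀ j, Measurable (Q j))
    (hQ_pos : ∀ j x, 0 < Q j x)
    (hQ_int : ∀ j, (∫ x : EuclideanSpace ℝ (Fin m), Q j x) = 1)
    (hQ_radial : ∀ j, ∀ x y : EuclideanSpace ℝ (Fin m),
      ‖x - θ‖ = ‖y - θ‖ → Q j x = Q j y)
    (hQ_rmlrp : ∀ j : Fin n, j ≠ jstar → ∀ x y : EuclideanSpace ℝ (Fin m),
      ‖x - θ‖ < ‖y - θ‖ → Q jstar y * Q j x < Q jstar x * Q j y)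
    (TA TB : EuclideanSpace ℝ (Fin m) → ℝ)
    (hTA_meas : Measurable TA) (hTB_meas : Measurable TB)
    (hTA_int : (∫ x : EuclideanSpace ℝ (Fin m), TA x) = 1)
    (hTB_int : (∫ x : EuclideanSpace ℝ (Fin m), TB x) = 1)
    (hTA_radial : ∀ x y : EuclideanSpace ℝ (Fin m), ‖x - θ‖ = ‖y - θ‖ → TA x = TA y)
    (hTB_radial : ∀ x y : EuclideanSpace ℝ (Fin m), ‖x - θ‖ = ‖y - θ‖ → TB x = TB y)
    (hTA_dec : ∀ x y : EuclideanSpace ℝ (Fin m), ‖x - θ‖ < ‖y - θ‖ → TA y < TA x)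
    (hTB_dec : ∀ x y : EuclideanSpace ℝ (Fin m), ‖x - θ‖ < ‖y - θ‖ → TB y < TB x)
    (hTA_pos : ∀ x, 0 < TA x) (hTB_pos : ∀ x, 0 < TB x)
    (hT_rmlrp : ∀ x y : EuclideanSpace ℝ (Fin m),
      ‖x - θ‖ < ‖y - θ‖ → TA y * TB x < TA x * TB y) :
    winProb m n jstar Q TB < winProb m n jstar Q TA := by
  have : NeZero m := ⟨by omega⟩
  have : Nontrivial (EuclideanSpace ℝ (Fin m)) := by
    refine ⟨⟨0, EuclideanSpace.single 0 1, fun h => ?_⟩⟩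
    have := congrArg norm h
    simp at this
  have hQi : ∀ j, Integrable (Q j) := fun j => by
    by_contra h
    have := hQ_int j
    rw [integral_undef h] at this
    norm_num at this
  have hTAi : Integrable TA := by
    by_contra h
    rw [integral_undef h] at hTA_int
    norm_num at hTA_int
  have hTBi : Integrable TB := by
    by_contra h
    rw [integral_undef h] at hTB_int
    norm_num at hTB_int
  have hPi : Integrable (fun x : Fin n → EuclideanSpace ℝ (Fin m) => ∏ j, Q j (x j)) :=
    Integrable.fintype_prod hQi
  have hP1 : ∫ x : Fin n → EuclideanSpace ℝ (Fin m), ∏ j, Q j (x j) = 1 := by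
    rw [integral_fintype_prod_volume_eq_prod]
    simp [hQ_int]
  have hPm : Measurable (fun x : Fin n → EuclideanSpace ℝ (Fin m) => ∏ j, Q j (x j)) :=
    Finset.measurable_prod _ fun j _ => (hQ_meas j).comp (measurable_pi_apply j)
  have hP0 : ∀ x : Fin n → EuclideanSpace ℝ (Fin m), 0 ≤ ∏ j, Q j (x j) := fun x =>
    Finset.prod_nonneg fun j _ => (hQ_pos _ _).le
  set w : EuclideanSpace ℝ (Fin m) → ℝ := wfun jstar Q with hw
  have hW : ∀ T, winProb m n jstar Q T = ∫ t, w t * T t := fun T => rfl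
  have hwm : StronglyMeasurable w := by
    have : Measurable (fun p : EuclideanSpace ℝ (Fin m) × (Fin n → EuclideanSpace ℝ (Fin m)) =>
      (if ∀ j : Fin n, j ≠ jstar → ‖p.2 jstar - p.1‖ < ‖p.2 j - p.1‖ then (1 : ℝ) else 0) *
        ∏ j : Fin n, Q j (p.2 j)) :=
      (Measurable.ite (win_meas jstar) measurable_const measurable_const).mul
        (hPm.comp measurable_snd)
    exact this.stronglyMeasurable.integral_prod_right'
  have hwb : ∀ t, ‖w t‖ ≤ 1 := by
    intro t
    have hn0 : 0 ≤ w t := integral_nonneg fun x => mul_nonneg (by split_ifs <;> norm_num) (hP0 x)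
    rw [Real.norm_of_nonneg hn0, ← hP1]
    refine integral_mono_of_nonneg (Filter.Eventually.of_forall fun x =>
      mul_nonneg (by split_ifs <;> norm_num) (hP0 x)) hPi (Filter.Eventually.of_forall fun x => ?_)
    refine mul_le_of_le_one_left (hP0 x) ?_
    split_ifs <;> norm_num
  have hwd : ∀ x y : EuclideanSpace ℝ (Fin m), ‖x - θ‖ < ‖y - θ‖ → w y < w x := by
    intro x y hxy
    have hy : 0 < ‖y - θ‖ := (norm_nonneg _).trans_lt hxy
    set u : EuclideanSpace ℝ (Fin m) := (‖y - θ‖)⁻¹ • (y - θ) with hu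
    have hu1 : ‖u‖ = 1 := by
      rw [hu, norm_smul, norm_inv, norm_norm, inv_mul_cancel₀ hy.ne']
    have hex : ∃ j : Fin n, j ≠ jstar := by
      have : Nontrivial (Fin n) := Fin.nontrivial_iff_two_le.2 hn
      exact exists_ne jstar
    have := wfun_ray jstar Q θ u hu1 ‖x - θ‖ ‖y - θ‖ (norm_nonneg _) hxy hex hQ_pos hPi hQ_rmlrp
    have e1 : wfun jstar Q x = wfun jstar Q (θ + ‖x - θ‖ • u) :=
      wfun_rot jstar Q θ hQ_radial _ _ (by simp [norm_smul, hu1])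
    have e2 : wfun jstar Q y = wfun jstar Q (θ + ‖y - θ‖ • u) :=
      wfun_rot jstar Q θ hQ_radial _ _ (by simp [norm_smul, hu1])
    rw [hw, e1, e2]
    exact this
  have hwA : Integrable (fun t => w t * TA t) :=
    hTAi.bdd_mul hwm.aestronglyMeasurable (Filter.Eventually.of_forall hwb)
  have hwB : Integrable (fun t => w t * TB t) :=
    hTBi.bdd_mul hwm.aestronglyMeasurable (Filter.Eventually.of_forall hwb)
  rw [hW, hW]
  have i1 := hwA.mul_prod hTBi
  have i2 := hwB.mul_prod hTAi
  have i3 := hTAi.mul_prod hwB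
  have i4 := hTBi.mul_prod hwA
  have hI : ∫ p : EuclideanSpace ℝ (Fin m) × EuclideanSpace ℝ (Fin m),
      ((w p.1 * TA p.1 * TB p.2 - w p.1 * TB p.1 * TA p.2) -
      (TA p.1 * (w p.2 * TB p.2) - TB p.1 * (w p.2 * TA p.2))) ∂(volume.prod volume) =
      2 * ((∫ t, w t * TA t) - ∫ t, w t * TB t) := by
    refine (integral_sub (i1.sub i2) (i3.sub i4)).trans ?_
    simp only [Pi.sub_apply]
    rw [integral_sub i1 i2, integral_sub i3 i4,
      integral_prod_mul (fun t => w t * TA t) TB, integral_prod_mul (fun t => w t * TB t) TA,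
      integral_prod_mul TA (fun t => w t * TB t), integral_prod_mul TB (fun t => w t * TA t),
      hTA_int, hTB_int]
    ring
  have hform : ∀ p : EuclideanSpace ℝ (Fin m) × EuclideanSpace ℝ (Fin m),
      ((w p.1 * TA p.1 * TB p.2 - w p.1 * TB p.1 * TA p.2) -
      (TA p.1 * (w p.2 * TB p.2) - TB p.1 * (w p.2 * TA p.2))) =
      (w p.1 - w p.2) * (TA p.1 * TB p.2 - TA p.2 * TB p.1) := fun p => by ring
  have hpos : 0 < ∫ p : EuclideanSpace ℝ (Fin m) × EuclideanSpace ℝ (Fin m),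
      ((w p.1 * TA p.1 * TB p.2 - w p.1 * TB p.1 * TA p.2) -
      (TA p.1 * (w p.2 * TB p.2) - TB p.1 * (w p.2 * TA p.2))) ∂(volume.prod volume) := by
    rw [integral_pos_iff_support_of_nonneg]
    · have ho : IsOpen {p : EuclideanSpace ℝ (Fin m) × EuclideanSpace ℝ (Fin m) |
          ‖p.1 - θ‖ < ‖p.2 - θ‖} := isOpen_lt (by fun_prop) (by fun_prop)
      refine lt_of_lt_of_le (ho.measure_pos (volume.prod volume) ?_) (measure_mono ?_)
      · obtain ⟨v, hv⟩ := exists_ne (0 : EuclideanSpace ℝ (Fin m))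
        exact ⟨(θ, θ + v), by simpa using hv⟩
      · intro p hp
        have hp' : ‖p.1 - θ‖ < ‖p.2 - θ‖ := hp
        rw [Function.mem_support, hform]
        exact (mul_pos (sub_pos.2 (hwd _ _ hp')) (sub_pos.2 (hT_rmlrp _ _ hp'))).ne'
    · intro p
      beta_reduce
      rw [Pi.zero_apply, hform]
      rcases lt_trichotomy ‖p.1 - θ‖ ‖p.2 - θ‖ with h | h | h
      · exact (mul_pos (sub_pos.2 (hwd _ _ h)) (sub_pos.2 (hT_rmlrp _ _ h))).le
      · rw [hTA_radial _ _ h, hTB_radial _ _ h]; simp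
      · exact (mul_pos_of_neg_of_neg (sub_neg.2 (hwd _ _ h))
          (sub_neg.2 (hT_rmlrp _ _ h))).le
    · exact (i1.sub i2).sub (i3.sub i4)
  linarith
end
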